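/- arXiv:2012.10919 — 2 statements merged into one kernel-verified Lean document; each statement's English description precedes it below -/
import Mathlib

section
/- With the ring-gadget construction below, the metric space (Y,d_Y) has doubling dimension log₂ 3; that is, every closed ball in (Y,d_Y) is contained in the union of at most 3 closed balls of half its radius. -/
/-- Circular distance between the `j`-th and `j'`-th of `m` points spaced regularly
on a circle of perimeter 1: `(1/m) · min(j'−j, m+j−j')` for `j ≤ j'`. -/
noncomputable def ringDist (m : ℕ) (j j' : Fin m) : ℝ :=
  ((min (max j.val j'.val - min j.val j'.val)
        (m - (max j.val j'.val - min j.val j'.val)) : ℕ) : ℝ) / (m : ℝ)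

/-- The distance on `Y = R_1 ∪ … ∪ R_k`, where `R_i = {p_{i1},…,p_{im}}` and the
point `p_{ij}` (with `1 ≤ i ≤ k`, `1 ≤ j ≤ m`) is encoded as
`(⟨i-1⟩, ⟨j-1⟩) : Fin k × Fin m`.  Within a ring the distance is the circular
distance `ringDist`; for `i ≠ i'`, `d_Y(p_{ij}, p_{i'j'}) = 2^{max(i,i')}` if
`(v_j, v_{j'}) ∈ E` and `2^{max(i,i')} − 1/m` otherwise (note
`max(i,i') = max(i-1,i'-1) + 1` in the 0-indexed encoding). -/
noncomputable def dY (m k : ℕ) (G : SimpleGraph (Fin m)) [DecidableRel G.Adj]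
    (p q : Fin k × Fin m) : ℝ :=
  if p.1 = q.1 then ringDist m p.2 q.2
  else if G.Adj p.2 q.2 then (2 : ℝ) ^ (max p.1.val q.1.val + 1)
  else (2 : ℝ) ^ (max p.1.val q.1.val + 1) - 1 / (m : ℝ)

/-- The distance on the pattern `X = {x_1,…,x_k}` (point `x_i` encoded as
`⟨i-1⟩ : Fin k`): `d_X(x_i, x_{i'}) = 2^{max(i,i')} · ρ` for `i ≠ i'`. -/
noncomputable def dX (k : ℕ) (ρ : ℝ) (i i' : Fin k) : ℝ :=
  if i = i' then 0 else (2 : ℝ) ^ (max i.val i'.val + 1) * ρ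

/-- `σ` is a `ρ`-matching from `(A, dA)` to `(B, dB)`:
`(1/ρ)·dA(a,a') ≤ dB(σ a, σ a') ≤ ρ·dA(a,a')` for all `a, a'`. -/
def IsRhoMatching {A B : Type*} (dA : A → A → ℝ) (dB : B → B → ℝ)
    (ρ : ℝ) (σ : A → B) : Prop :=
  ∀ a a', (1 / ρ) * dA a a' ≤ dB (σ a) (σ a') ∧ dB (σ a) (σ a') ≤ ρ * dA a a'

/-- On a cycle of `m` points, the points within `s` steps of `j` are covered by three balls of
radius `s / 2` steps. -/
theorem exists_three_centers_cycle (m s : ℕ) (j : Fin m) : ∃ c₁ c₂ c₃ : Fin m, ∀ l : Fin m,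
    min (max j.val l.val - min j.val l.val) (m - (max j.val l.val - min j.val l.val)) ≤ s →
      (∃ c, (c = c₁ ∨ c = c₂ ∨ c = c₃) ∧
        min (max c.val l.val - min c.val l.val) (m - (max c.val l.val - min c.val l.val))
          ≤ s / 2) := by
  obtain ⟨j, hj⟩ := j
  by_cases hs : m ≤ s / 2 + 1
  · refine ⟨⟨j, hj⟩, ⟨j, hj⟩, ⟨j, hj⟩, fun l _ => ⟨⟨j, hj⟩, Or.inl rfl, ?_⟩⟩
    have := l.isLt
    dsimp only
    omega
  · let right : ℕ := if j + (s / 2 + 1) < m then j + (s / 2 + 1) else j + (s / 2 + 1) - m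
    let left : ℕ := if s / 2 + 1 ≤ j then j - (s / 2 + 1) else j + m - (s / 2 + 1)
    have hright : right < m := by grind
    have hleft : left < m := by grind
    refine ⟨⟨j, hj⟩, ⟨right, hright⟩, ⟨left, hleft⟩, fun l hl => ?_⟩
    have := l.isLt
    dsimp only at hl
    by_contra hcon
    push Not at hcon
    have h₁ := hcon _ (Or.inl rfl)
    have h₂ := hcon _ (Or.inr (Or.inl rfl))
    have h₃ := hcon _ (Or.inr (Or.inr rfl))
    dsimp only [right, left] at h₁ h₂ h₃
    clear hcon hright hleft
    split_ifs at h₂ h₃ <;> omega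

theorem ringDist_le_iff {m : ℕ} (hm : 0 < m) (j l : Fin m) {r : ℝ} (hr : 0 ≤ r) :
    ringDist m j l ≤ r ↔
      min (max j.val l.val - min j.val l.val) (m - (max j.val l.val - min j.val l.val))
        ≤ ⌊r * m⌋₊ := by
  have hm' : (0 : ℝ) < m := by exact_mod_cast hm
  rw [ringDist, div_le_iff₀ hm', Nat.le_floor_iff (by positivity)]

theorem ringDist_nonneg (m : ℕ) (j l : Fin m) : 0 ≤ ringDist m j l := by
  unfold ringDist
  positivity

theorem ringDist_le_half (m : ℕ) (j l : Fin m) : ringDist m j l ≤ 1 / 2 := by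
  have hm : (0 : ℝ) < m := by exact_mod_cast j.pos
  rw [ringDist, div_le_iff₀ hm]
  have h : min (max j.val l.val - min j.val l.val) (m - (max j.val l.val - min j.val l.val)) * 2
      ≤ m := by omega
  have h' : ((min (max j.val l.val - min j.val l.val)
      (m - (max j.val l.val - min j.val l.val)) : ℕ) : ℝ) * 2 ≤ m := by exact_mod_cast h
  linarith

/-- Balls in a single ring are covered by three balls of half the radius. -/
theorem exists_three_centers_ring (m : ℕ) (j : Fin m) (r : ℝ) : ∃ c₁ c₂ c₃ : Fin m, ∀ l : Fin m,
    ringDist m j l ≤ r →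
      ringDist m c₁ l ≤ r / 2 ∨ ringDist m c₂ l ≤ r / 2 ∨ ringDist m c₃ l ≤ r / 2 := by
  rcases lt_or_ge r 0 with hr | hr
  · exact ⟨j, j, j, fun l hl => absurd ((ringDist_nonneg m j l).trans hl) hr.not_ge⟩
  · obtain ⟨c₁, c₂, c₃, hc⟩ := exists_three_centers_cycle m ⌊r * m⌋₊ j
    refine ⟨c₁, c₂, c₃, fun l hl => ?_⟩
    have hfloor : ⌊r / 2 * m⌋₊ = ⌊r * m⌋₊ / 2 := by
      rw [← Nat.floor_div_ofNat]
      congr 1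
      ring
    obtain ⟨c, hmem, hcl⟩ := hc l ((ringDist_le_iff j.pos j l hr).1 hl)
    rw [← hfloor, ← ringDist_le_iff j.pos c l (by positivity)] at hcl
    rcases hmem with rfl | rfl | rfl
    · exact Or.inl hcl
    · exact Or.inr (Or.inl hcl)
    · exact Or.inr (Or.inr hcl)

section

variable {m k : ℕ} {G : SimpleGraph (Fin m)} [DecidableRel G.Adj] {p q : Fin k × Fin m}

theorem dY_of_eq (h : p.1 = q.1) : dY m k G p q = ringDist m p.2 q.2 := if_pos h

theorem dY_le_of_ne (h : p.1 ≠ q.1) : dY m k G p q ≤ 2 ^ (max p.1.val q.1.val + 1) := by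
  have : (0 : ℝ) ≤ 1 / m := by positivity
  rw [dY, if_neg h]
  split_ifs <;> linarith

theorem le_dY_of_ne (h : p.1 ≠ q.1) :
    (2 : ℝ) ^ (max p.1.val q.1.val + 1) - 1 / m ≤ dY m k G p q := by
  have : (0 : ℝ) ≤ 1 / m := by positivity
  rw [dY, if_neg h]
  split_ifs <;> linarith

/-- The rings of index at most `b` are covered by three balls, centred in the rings `b`, `b - 1`
and `b - 2`, of any radius that is at least `1 / 2` and `2 ^ (b - 1)`. -/
theorem exists_three_centers_rings (b : Fin k) (j : Fin m) {r : ℝ} (hr : 1 / 2 ≤ r)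
    (hb : (2 : ℝ) ^ (b.val - 1) ≤ r) : ∃ c₁ c₂ c₃ : Fin k × Fin m, ∀ q : Fin k × Fin m,
      q.1 ≤ b → dY m k G c₁ q ≤ r ∨ dY m k G c₂ q ≤ r ∨ dY m k G c₃ q ≤ r := by
  have hring : ∀ c q : Fin k × Fin m, c.1 = q.1 → dY m k G c q ≤ r := fun c q h =>
    (dY_of_eq h).trans_le ((ringDist_le_half m _ _).trans hr)
  refine ⟨(b, j), (⟨b.val - 1, by omega⟩, j), (⟨b.val - 2, by omega⟩, j), fun q hq => ?_⟩
  rw [Fin.le_def] at hq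
  by_cases h₁ : b.val = q.1.val
  · exact Or.inl (hring _ _ (Fin.ext h₁))
  by_cases h₂ : b.val - 1 = q.1.val
  · exact Or.inr (Or.inl (hring _ _ (Fin.ext h₂)))
  right; right
  by_cases h₃ : b.val - 2 = q.1.val
  · exact hring _ _ (Fin.ext h₃)
  refine (dY_le_of_ne fun h => h₃ (congrArg Fin.val h)).trans (le_trans (le_of_eq ?_) hb)
  congr 1
  dsimp only
  omega

end

/-- **Lemma (Y is doubling with dimension log₂ 3).** With the ring-gadget
construction (for a simple graph `G` on `m ≥ 24` vertices and `k ≥ 1` rings),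
every closed ball of `(Y, d_Y)` is contained in the union of at most three
(`= 2 ^ (log₂ 3)`) closed balls of half its radius. -/
theorem stmt_4 (m k : ℕ) (hm : 24 ≤ m) (hk : 1 ≤ k)
    (G : SimpleGraph (Fin m)) [DecidableRel G.Adj] :
    ∀ (p : Fin k × Fin m) (r : ℝ), ∃ c₁ c₂ c₃ : Fin k × Fin m,
      {q : Fin k × Fin m | dY m k G p q ≤ r} ⊆
        {q | dY m k G c₁ q ≤ r / 2} ∪ {q | dY m k G c₂ q ≤ r / 2} ∪
        {q | dY m k G c₃ q ≤ r / 2} := by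
  intro p r
  suffices h : ∃ c₁ c₂ c₃ : Fin k × Fin m, ∀ q, dY m k G p q ≤ r →
      dY m k G c₁ q ≤ r / 2 ∨ dY m k G c₂ q ≤ r / 2 ∨ dY m k G c₃ q ≤ r / 2 by
    obtain ⟨c₁, c₂, c₃, h⟩ := h
    exact ⟨c₁, c₂, c₃, fun q hq => or_assoc.2 (h q hq)⟩
  by_cases hball : ∀ q, dY m k G p q ≤ r → p.1 = q.1
  · obtain ⟨c₁, c₂, c₃, hc⟩ := exists_three_centers_ring m p.2 r
    refine ⟨(p.1, c₁), (p.1, c₂), (p.1, c₃), fun q hq => ?_⟩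
    have h := hball q hq
    rw [dY_of_eq h] at hq
    rw [dY_of_eq (p := (p.1, c₁)) h, dY_of_eq (p := (p.1, c₂)) h, dY_of_eq (p := (p.1, c₃)) h]
    exact hc q.2 hq
  · push Not at hball
    obtain ⟨q₀, hq₀, hmax⟩ := Set.exists_max_image {q | dY m k G p q ≤ r ∧ p.1 ≠ q.1}
      (fun q => max p.1 q.1) (Set.toFinite _) hball
    have hb : 1 ≤ (max p.1 q₀.1).val := by
      have : p.1.val ≠ q₀.1.val := fun h => hq₀.2 (Fin.ext h)
      rw [Fin.coe_max]
      omega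
    have hr := (le_dY_of_ne (G := G) hq₀.2).trans hq₀.1
    rw [← Fin.coe_max] at hr
    obtain ⟨n, hn⟩ := Nat.exists_eq_add_of_le' hb
    have hinv : 1 / (m : ℝ) ≤ 1 :=
      div_le_one_of_le₀ (by exact_mod_cast (by omega : 1 ≤ m)) (by positivity)
    have hpow : (1 : ℝ) ≤ 2 ^ n := one_le_pow₀ one_le_two
    have hr' : (2 : ℝ) ^ n ≤ r / 2 := by
      rw [hn, pow_succ, pow_succ] at hr
      linarith
    obtain ⟨c₁, c₂, c₃, hc⟩ := exists_three_centers_rings (G := G) (max p.1 q₀.1) p.2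
      (r := r / 2) (by linarith) (by rw [hn, Nat.add_sub_cancel]; exact hr')
    refine ⟨c₁, c₂, c₃, fun q hq => hc q ?_⟩
    by_cases h : p.1 = q.1
    · exact h ▸ le_max_left _ _
    · exact (le_max_right _ _).trans (hmax q ⟨hq, h⟩)
end

section
/- With the reduction construction below, let σ : X → Y be a ρ-matching and write y_i = σ(x_i). Then each ring R_1,…,R_k contains exactly one of the points y_1,…,y_k, and y_i ∈ R_i for every i with 3 ≤ i ≤ k. -/
theorem ringDist_le_one (m : ℕ) (j j' : Fin m) : ringDist m j j' ≤ 1 := by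
  unfold ringDist
  refine div_le_one_of_le₀ ?_ (Nat.cast_nonneg m)
  exact_mod_cast (min_le_right _ _).trans (Nat.sub_le _ _)

theorem dY_le_two_pow (m k : ℕ) (G : SimpleGraph (Fin m)) [DecidableRel G.Adj]
    {p q : Fin k × Fin m} (h : p.1 ≠ q.1) :
    dY m k G p q ≤ (2 : ℝ) ^ (max p.1.val q.1.val + 1) := by
  unfold dY
  rw [if_neg h]
  split_ifs
  · exact le_rfl
  · exact sub_le_self _ (by positivity)

theorem two_pow_le_dY_of_isRhoMatching {m k : ℕ} {ρ : ℝ} (hρ : 1 ≤ ρ)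
    {G : SimpleGraph (Fin m)} [DecidableRel G.Adj] {σ : Fin k → Fin k × Fin m}
    (hσ : IsRhoMatching (dX k ρ) (dY m k G) ρ σ) {i i' : Fin k} (h : i ≠ i') :
    (2 : ℝ) ^ (max i.val i'.val + 1) ≤ dY m k G (σ i) (σ i') := by
  have hlow := (hσ i i').1
  have hρ0 : ρ ≠ 0 := by positivity
  rw [dX, if_neg h] at hlow
  convert hlow using 1
  field_simp

/-- A permutation of `Fin k` that does not decrease the maximum of any two distinct elements
fixes every element other than `0` and `1`. -/
theorem Fin.eq_self_of_injective_of_max_le {k : ℕ} {r : Fin k → Fin k}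
    (hr : Function.Injective r)
    (hmax : ∀ i i', i ≠ i' → max i.val i'.val ≤ max (r i).val (r i').val)
    (i : Fin k) (hi : 2 ≤ i.val) : r i = i := by
  induction i using WellFoundedGT.induction with
  | ind i ih =>
    have hle : ∀ j ≤ i, r j ≤ i := by
      intro j hj
      by_contra! hlt
      have hfix := ih (r j) hlt (hi.trans (Fin.le_def.1 hlt.le))
      exact absurd (hr hfix ▸ hlt) hj.not_gt
    have hik := i.isLt
    by_contra hne
    have hlt : (r i).val < i.val := lt_of_le_of_ne (hle i le_rfl) (Fin.val_ne_of_ne hne)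
    have hval : ∀ j < i, r j = i := by
      intro j hj
      have hmax' := hmax i j hj.ne'
      have hle' := Fin.le_def.1 (hle j hj.le)
      apply Fin.ext
      omega
    have h01 := hr ((hval ⟨0, by omega⟩ (Fin.lt_def.2 (by simp only; omega))).trans
      (hval ⟨1, by omega⟩ (Fin.lt_def.2 (by simp only; omega))).symm)
    simp at h01

/-- **Lemma (rings are matched naturally).** With the reduction construction, if
`σ : X → Y` is a `ρ`-matching and `y_i = σ(x_i)`, then each ring contains
exactly one of the points `y_1,…,y_k` (the ring of `y_i` is its first
coordinate), and `y_i ∈ R_i` for every `i` with `3 ≤ i ≤ k` (in the 0-indexed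
encoding, the paper's index of `x_i` is `i.val + 1`). -/
theorem stmt_7 (m k : ℕ) (hm : 24 ≤ m) (hk : 1 ≤ k) (hkm : k ≤ m)
    (ρ : ℝ) (hρ : 1 ≤ ρ) (G : SimpleGraph (Fin m)) [DecidableRel G.Adj]
    (σ : Fin k → Fin k × Fin m)
    (hσ : IsRhoMatching (dX k ρ) (dY m k G) ρ σ) :
    (∀ t : Fin k, ∃! i : Fin k, (σ i).1 = t) ∧
    (∀ i : Fin k, 3 ≤ i.val + 1 → (σ i).1 = i) := by
  have hinj : Function.Injective fun i => (σ i).1 := by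
    intro i i' heq
    by_contra hne
    have hlow := two_pow_le_dY_of_isRhoMatching hρ hσ hne
    rw [dY, if_pos heq] at hlow
    have hone := hlow.trans (ringDist_le_one m _ _)
    have hgt : (1 : ℝ) < 2 ^ (max i.val i'.val + 1) :=
      one_lt_pow₀ one_lt_two (Nat.succ_ne_zero _)
    linarith
  refine ⟨(Finite.injective_iff_bijective.1 hinj).existsUnique, fun i hi =>
    Fin.eq_self_of_injective_of_max_le hinj (fun i i' hne => ?_) i (by omega)⟩
  have hpow := (two_pow_le_dY_of_isRhoMatching hρ hσ hne).trans
    (dY_le_two_pow m k G (hinj.ne hne))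
  exact Nat.le_of_succ_le_succ ((pow_le_pow_iff_right₀ one_lt_two).1 hpow)
end
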